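/- Fix a buyer i with budget b_i > 0 and fixed allocations x*_k ∈ ℝ_{≥0}^m for every other buyer k ≠ i, and suppose x ↦ u_i(x, X*_{-i}), defined on ℝ_{≥0}^m, is continuous, concave, and homogeneous of degree one. Let p ∈ ℝ^m with p_j > 0 for every j, and let x̂ maximize x ↦ u_i(x, X*_{-i}) over {x ∈ ℝ_{≥0}^m : x · p ≤ b_i} with u_i(x̂, X*_{-i}) > 0. Then the negative excess demand g := 1 − Σ_{k≠i} x*_k − x̂ is a subgradient of the value function V_i at p: for every q ∈ ℝ^m with q_j > 0 for all j, V_i(q) ≥ V_i(p) + g · (q − p). -/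

import Mathlib

open Finset

/-- The extended-real logarithm: `log t = −∞` for `t ≤ 0`. -/
noncomputable def elog (t : ℝ) : EReal :=
  if t ≤ 0 then ⊥ else ((Real.log t : ℝ) : EReal)

/-- The auctioneer's value function in buyer `i`'s Stackelberg game, where
`u = u_i(·, X*_{-i})` and `other j = Σ_{k≠i} x*_{kj}`:
`V_i(p) = sup { Σ_j p_j (1 − other j) + b log u(x) : x ∈ ℝ_{≥0}^m, x·p ≤ b }`. -/
noncomputable def Vfun (m : ℕ) (u : (Fin m → ℝ) → ℝ) (b : ℝ)
    (other : Fin m → ℝ) (p : Fin m → ℝ) : EReal :=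
  ⨆ x : {x : Fin m → ℝ // (∀ j, 0 ≤ x j) ∧ ∑ j, x j * p j ≤ b},
    ((∑ j, p j * (1 - other j) : ℝ) : EReal) + (b : EReal) * elog (u x.1)

theorem elog_of_pos {t : ℝ} (ht : 0 < t) : elog t = ((Real.log t : ℝ) : EReal) :=
  if_neg ht.not_ge

theorem elog_of_nonpos {t : ℝ} (ht : t ≤ 0) : elog t = ⊥ :=
  if_pos ht

/-- The objective at a bundle of positive utility bounds the value function from below. -/
theorem coe_le_Vfun {m : ℕ} {u : (Fin m → ℝ) → ℝ} {b : ℝ} {other q x : Fin m → ℝ}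
    (hx : ∀ j, 0 ≤ x j) (hxb : ∑ j, x j * q j ≤ b) (hu : 0 < u x) :
    ((∑ j, q j * (1 - other j) + b * Real.log (u x) : ℝ) : EReal) ≤ Vfun m u b other q := by
  refine le_trans (le_of_eq ?_) (le_iSup _ ⟨x, hx, hxb⟩)
  rw [elog_of_pos hu, ← EReal.coe_mul, ← EReal.coe_add]

/-- An upper bound on utility over the budget set bounds the value function from above. -/
theorem Vfun_le_coe {m : ℕ} {u : (Fin m → ℝ) → ℝ} {b : ℝ} (hb : 0 < b) {other p : Fin m → ℝ}
    {t : ℝ} (ht : ∀ x : Fin m → ℝ, (∀ j, 0 ≤ x j) → ∑ j, x j * p j ≤ b → u x ≤ t) :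
    Vfun m u b other p ≤ ((∑ j, p j * (1 - other j) + b * Real.log t : ℝ) : EReal) := by
  refine iSup_le fun ⟨x, hx, hxb⟩ => ?_
  rcases le_or_gt (u x) 0 with h | h
  · rw [elog_of_nonpos h, EReal.coe_mul_bot_of_pos hb, EReal.add_bot]
    exact bot_le
  · rw [elog_of_pos h, ← EReal.coe_mul, ← EReal.coe_add, EReal.coe_le_coe_iff]
    gcongr
    exact ht x hx hxb

/-- If `x̂` maximizes buyer `i`'s continuous, concave, degree-one
homogeneous utility over the budget set at strictly positive prices `p`, with
`u(x̂) > 0`, then the negative excess demand `1 − Σ_{k≠i} x*_k − x̂` is a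
subgradient of the value function `V_i` at `p`. -/
theorem negative_excess_demand_is_subgradient
    (n m : ℕ) (i : Fin n) (b : ℝ) (hb : 0 < b)
    (xstar : Fin n → Fin m → ℝ)
    (hxstar : ∀ k, k ≠ i → ∀ j, 0 ≤ xstar k j)
    (u : (Fin m → ℝ) → ℝ)
    (hcont : ContinuousOn u {x : Fin m → ℝ | ∀ j, 0 ≤ x j})
    (hconc : ConcaveOn ℝ {x : Fin m → ℝ | ∀ j, 0 ≤ x j} u)
    (hhom : ∀ c : ℝ, 0 ≤ c → ∀ x : Fin m → ℝ, (∀ j, 0 ≤ x j) → u (c • x) = c * u x)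
    (p : Fin m → ℝ) (hp : ∀ j, 0 < p j)
    (xhat : Fin m → ℝ) (hxhat₀ : ∀ j, 0 ≤ xhat j)
    (hxhatb : ∑ j, xhat j * p j ≤ b)
    (hxhatmax : ∀ x : Fin m → ℝ, (∀ j, 0 ≤ x j) → (∑ j, x j * p j ≤ b) → u x ≤ u xhat)
    (hupos : 0 < u xhat) :
    ∀ q : Fin m → ℝ, (∀ j, 0 < q j) →
      Vfun m u b (fun j => ∑ k ∈ Finset.univ.erase i, xstar k j) p
        + ((∑ j, (1 - (∑ k ∈ Finset.univ.erase i, xstar k j) - xhat j) * (q j - p j) : ℝ) : EReal)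
      ≤ Vfun m u b (fun j => ∑ k ∈ Finset.univ.erase i, xstar k j) q := by
  intro q hq
  set other : Fin m → ℝ := fun j => ∑ k ∈ Finset.univ.erase i, xstar k j
  set s := ∑ j, xhat j * q j with hs
  have hterm : ∀ j ∈ Finset.univ, 0 ≤ xhat j * q j := fun j _ =>
    mul_nonneg (hxhat₀ j) (hq j).le
  have hspos : 0 < s := by
    refine (Finset.sum_nonneg hterm).lt_of_ne fun h => hupos.ne' ?_
    have hzero : xhat = 0 := funext fun j =>
      (mul_eq_zero.mp ((Finset.sum_eq_zero_iff_of_nonneg hterm).mp h.symm j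
        (Finset.mem_univ j))).resolve_right (hq j).ne'
    simpa [hzero] using hhom 0 le_rfl xhat hxhat₀
  have hc : 0 < b / s := div_pos hb hspos
  have hcx : u ((b / s) • xhat) = b / s * u xhat := hhom _ hc.le _ hxhat₀
  have hlower : ((∑ j, q j * (1 - other j) + b * Real.log (u ((b / s) • xhat)) : ℝ) : EReal)
      ≤ Vfun m u b other q := by
    refine coe_le_Vfun (fun j => mul_nonneg hc.le (hxhat₀ j)) ?_ (hcx ▸ mul_pos hc hupos)
    simp only [Pi.smul_apply, smul_eq_mul, mul_assoc, ← Finset.mul_sum]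
    rw [← hs, div_mul_cancel₀ b hspos.ne']
  refine le_trans (add_le_add_left (Vfun_le_coe hb hxhatmax) _) (le_trans ?_ hlower)
  rw [← EReal.coe_add, EReal.coe_le_coe_iff, hcx, Real.log_mul hc.ne' hupos.ne']
  have hlog : b - s ≤ b * Real.log (b / s) := by
    have h := mul_le_mul_of_nonneg_left (Real.one_sub_inv_le_log_of_pos hc) hb.le
    rwa [inv_div, mul_sub, mul_one, mul_div_cancel₀ s hb.ne'] at h
  have hsplit : ∑ j, (1 - other j - xhat j) * (q j - p j) =
      ∑ j, q j * (1 - other j) - ∑ j, p j * (1 - other j) - s + ∑ j, xhat j * p j := by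
    rw [hs, ← Finset.sum_sub_distrib, ← Finset.sum_sub_distrib, ← Finset.sum_add_distrib]
    exact Finset.sum_congr rfl fun j _ => by ring
  change _ + ∑ j, (1 - other j - xhat j) * (q j - p j) ≤ _
  rw [hsplit]
  linarith
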